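/- For every integer N ≥ 1, the number of aperiodic admissible N-tuples is given by A_N = ∑_{d ∣ N, d odd} μ(d) · 2^{N/d − 1}, where μ is the Möbius function and the sum ranges over the odd positive divisors of N. -/

import Mathlib

/-- An admissible `m`-tuple: `λ : Fin m → ℕ` with `∑ (λᵢ + 1) = 2m` and every consecutive
sum `∑_{k=i}^{j} (λₖ + 1) ≠ m` for `i ≤ j`. -/
def Admissible (m : ℕ) (lam : Fin m → ℕ) : Prop :=
  (∑ i, (lam i + 1)) = 2 * m ∧
  ∀ i j : Fin m, i ≤ j → (∑ k ∈ Finset.Icc i j, (lam k + 1)) ≠ m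

/-- `λ` is `d`-periodic: `λ_{(k+d) mod m} = λ_k` for all `k`. -/
def IsPeriodic (m d : ℕ) (lam : Fin m → ℕ) : Prop :=
  ∀ k : Fin m, lam ⟨((k : ℕ) + d) % m, Nat.mod_lt _ (Nat.zero_lt_of_lt k.isLt)⟩ = lam k

/-- `λ` is aperiodic: the only `d` with `1 ≤ d ≤ m` for which `λ` is `d`-periodic is
`d = m`. -/
def Aperiodic (m : ℕ) (lam : Fin m → ℕ) : Prop :=
  ∀ d : ℕ, 1 ≤ d → d ≤ m → IsPeriodic m d lam → d = m

/-- `A m` is the number of aperiodic admissible `m`-tuples. -/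
noncomputable def numAperiodic (m : ℕ) : ℕ :=
  Nat.card {lam : Fin m → ℕ // Admissible m lam ∧ Aperiodic m lam}

/-- The sum of the first `n` terms of the sequence `k ↦ a k + 1`. -/
def partialSum (a : ℕ → ℕ) (n : ℕ) : ℕ := ∑ k ∈ Finset.range n, (a k + 1)

theorem partialSum_zero (a : ℕ → ℕ) : partialSum a 0 = 0 := rfl

theorem partialSum_succ (a : ℕ → ℕ) (n : ℕ) :
    partialSum a (n + 1) = partialSum a n + (a n + 1) :=
  Finset.sum_range_succ _ _

theorem partialSum_strictMono (a : ℕ → ℕ) : StrictMono (partialSum a) :=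
  strictMono_nat_of_lt_succ fun n => by rw [partialSum_succ]; omega

theorem partialSum_injective : Function.Injective partialSum := fun a b h => by
  funext n
  have h₁ := partialSum_succ a n
  rw [h, partialSum_succ b n] at h₁
  omega

theorem partialSum_add_period {a : ℕ → ℕ} {d : ℕ} (h : Function.Periodic a d) (n : ℕ) :
    partialSum a (n + d) = partialSum a n + partialSum a d := by
  induction n with
  | zero => simp [partialSum_zero]
  | succ n ih =>
    rw [show n + 1 + d = n + d + 1 by ring, partialSum_succ, partialSum_succ, ih, h n]
    ring

theorem partialSum_add_mul_period {a : ℕ → ℕ} {d : ℕ} (h : Function.Periodic a d) (n t : ℕ) :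
    partialSum a (n + t * d) = partialSum a n + t * partialSum a d := by
  induction t with
  | zero => simp
  | succ t ih =>
    rw [show n + (t + 1) * d = n + t * d + d by ring, partialSum_add_period h, ih]
    ring

theorem partialSum_add_sum_Icc (a : ℕ → ℕ) {m : ℕ} {i j : Fin m} (hij : i ≤ j) :
    partialSum a i + ∑ k ∈ Finset.Icc i j, (a k + 1) = partialSum a (j + 1) := by
  have h : ∑ k ∈ Finset.Icc i j, (a k + 1) = ∑ k ∈ Finset.Ico (i : ℕ) (j + 1), (a k + 1) := by
    have := Finset.sum_map (Finset.Icc i j) Fin.valEmbedding (fun k => a k + 1)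
    rw [Fin.map_valEmbedding_Icc] at this
    exact this.symm
  rw [h, partialSum, partialSum, Finset.sum_range_add_sum_Ico]
  exact Nat.le_succ_of_le hij

/-- The periodic sequences corresponding to admissible `m`-tuples. -/
structure IsAdmissibleSeq (m : ℕ) (a : ℕ → ℕ) : Prop where
  periodic : Function.Periodic a m
  sum_eq : partialSum a m = 2 * m
  ne_add : ∀ i j, partialSum a j ≠ partialSum a i + m

theorem admissible_iff_isAdmissibleSeq {m : ℕ} (hm : 0 < m) {a : ℕ → ℕ}
    (ha : Function.Periodic a m) :
    Admissible m (fun k => a k) ↔ IsAdmissibleSeq m a := by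
  have hsum : ∑ i : Fin m, (a i + 1) = partialSum a m :=
    (Finset.sum_range fun k => a k + 1).symm
  constructor
  · rintro ⟨h₁, h₂⟩
    rw [hsum] at h₁
    have hadd (n : ℕ) : partialSum a (n + m) = partialSum a n + 2 * m := by
      rw [partialSum_add_period ha, h₁]
    have hmono := partialSum_strictMono a
    have base {i j : ℕ} (hi : i < m) (hj : j ≤ m) : partialSum a j ≠ partialSum a i + m := by
      intro h
      have hij : i < j := hmono.lt_iff_lt.1 (by omega)
      have hne := h₂ ⟨i, hi⟩ ⟨j - 1, by omega⟩ (Fin.mk_le_mk.2 (by omega))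
      have := partialSum_add_sum_Icc a (m := m) (i := ⟨i, hi⟩) (j := ⟨j - 1, by omega⟩)
        (Fin.mk_le_mk.2 (by omega))
      simp only [show j - 1 + 1 = j by omega] at this hne
      omega
    refine ⟨ha, h₁, fun i => ?_⟩
    induction i using Nat.strong_induction_on with
    | _ i ih =>
    intro j h
    have hij : i < j := hmono.lt_iff_lt.1 (by omega)
    rcases lt_or_ge i m with hi | hi
    · rcases le_or_gt j m with hj | hj
      · exact base hi hj h
      · obtain ⟨j, rfl⟩ := Nat.exists_eq_add_of_le' hj.le
        rw [hadd] at h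
        have hji : j < i := hmono.lt_iff_lt.1 (by omega)
        exact base (i := j) (j := i) (by omega) hi.le (by omega)
    · obtain ⟨i, rfl⟩ := Nat.exists_eq_add_of_le' hi
      obtain ⟨j, rfl⟩ := Nat.exists_eq_add_of_le' (hi.trans hij.le)
      rw [hadd, hadd] at h
      exact ih i (by omega) j (by omega)
  · intro h
    refine ⟨hsum.trans h.sum_eq, fun i j hij he => h.ne_add i (j + 1) ?_⟩
    rw [← partialSum_add_sum_Icc a hij, he]

theorem isPeriodic_iff_periodic {m d : ℕ} (hm : 0 < m) {a : ℕ → ℕ}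
    (ha : Function.Periodic a m) :
    IsPeriodic m d (fun k => a k) ↔ Function.Periodic a d := by
  simp only [IsPeriodic, ha.map_mod_nat]
  refine ⟨fun h k => ?_, fun h k => h k⟩
  have := h ⟨k % m, Nat.mod_lt _ hm⟩
  simp only [ha.map_mod_nat] at this
  rw [← this, ← ha.map_mod_nat (k + d), ← ha.map_mod_nat (k % m + d), Nat.mod_add_mod]

/-- Tuples of length `m` are the same as `m`-periodic sequences. -/
def tupleEquivPeriodic {m : ℕ} (hm : 0 < m) :
    (Fin m → ℕ) ≃ {a : ℕ → ℕ // Function.Periodic a m} where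
  toFun lam := ⟨fun k => lam ⟨k % m, Nat.mod_lt _ hm⟩, fun k => by simp⟩
  invFun a k := a.1 k
  left_inv lam := by
    funext k
    simp [Nat.mod_eq_of_lt k.isLt]
  right_inv a := by
    ext k
    exact a.2.map_mod_nat k

theorem numAperiodic_eq_card {m : ℕ} (hm : 0 < m) :
    numAperiodic m = Nat.card {a : ℕ → ℕ // IsAdmissibleSeq m a ∧
      ∀ d, 1 ≤ d → d ≤ m → Function.Periodic a d → d = m} := by
  have e : {lam : Fin m → ℕ // Admissible m lam ∧ Aperiodic m lam} ≃
      {a : {a : ℕ → ℕ // Function.Periodic a m} // IsAdmissibleSeq m a.1 ∧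
        ∀ d, 1 ≤ d → d ≤ m → Function.Periodic a.1 d → d = m} := by
    refine ((tupleEquivPeriodic hm).symm.subtypeEquiv fun a => ?_).symm
    change _ ↔ Admissible m (fun k => a.1 k) ∧ Aperiodic m (fun k => a.1 k)
    simp only [Aperiodic, admissible_iff_isAdmissibleSeq hm a.2, isPeriodic_iff_periodic hm a.2]
  exact Nat.card_congr (e.trans (Equiv.subtypeSubtypeEquivSubtype
    (q := fun a => IsAdmissibleSeq m a ∧ ∀ d, 1 ≤ d → d ≤ m → Function.Periodic a d → d = m)
    fun h => h.1.periodic))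

theorem IsAdmissibleSeq.add_mem_range_iff {m : ℕ} (hm : 0 < m) {a : ℕ → ℕ}
    (h : IsAdmissibleSeq m a) (x : ℕ) :
    x + m ∈ Set.range (partialSum a) ↔ x ∉ Set.range (partialSum a) := by
  constructor
  · rintro ⟨j, hj⟩ ⟨i, hi⟩
    exact h.ne_add i j (by rw [hi, hj])
  · intro hx
    have hlt {i : ℕ} (hi : i < m) : partialSum a i < 2 * m :=
      h.sum_eq ▸ partialSum_strictMono a hi
    have hmod (x : ℕ) (hx : x < 2 * m) : x % m = if x < m then x else x - m := by
      split_ifs with h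
      · exact Nat.mod_eq_of_lt h
      · rw [Nat.mod_eq_sub_mod (not_lt.1 h), Nat.mod_eq_of_lt (by omega)]
    have hinj : Set.InjOn (fun i => partialSum a i % m) (Finset.range m) := by
      intro i hi j hj hij
      have hi := hlt (Finset.mem_range.1 hi)
      have hj := hlt (Finset.mem_range.1 hj)
      refine (partialSum_strictMono a).injective ?_
      have h₁ := h.ne_add i j
      have h₂ := h.ne_add j i
      simp only [hmod _ hi, hmod _ hj] at hij
      split_ifs at hij <;> omega
    have hsurj := Finset.surjOn_of_injOn_of_card_le (s := Finset.range m) (t := Finset.range m)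
      (fun i => partialSum a i % m) (fun i _ => by simpa using Nat.mod_lt _ hm) hinj le_rfl
    obtain ⟨i, hi, hix⟩ := hsurj (show x % m ∈ _ by simpa using Nat.mod_lt _ hm)
    have hi := hlt (Finset.mem_range.1 (Finset.mem_coe.1 hi))
    have hmem (t : ℕ) : partialSum a i + t * (2 * m) ∈ Set.range (partialSum a) :=
      ⟨i + t * m, by rw [partialSum_add_mul_period h.periodic, h.sum_eq]⟩
    have hx' := Nat.mod_add_div x m
    have hi' := Nat.mod_add_div (partialSum a i) m
    simp only at hix
    rw [hix] at hi'
    have hq : partialSum a i / m < 2 := Nat.div_lt_of_lt_mul (by omega)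
    generalize partialSum a i / m = q at hi' hq
    obtain ⟨t, ht | ht⟩ := Nat.even_or_odd' (x / m) <;> rw [ht] at hx' <;> interval_cases q
    · exact absurd (by convert hmem t using 1; rw [← hx', ← hi']; ring) hx
    · convert hmem t using 1; rw [← hx', ← hi']; ring
    · convert hmem (t + 1) using 1; rw [← hx', ← hi']; ring
    · exact absurd (by convert hmem t using 1; rw [← hx', ← hi']; ring) hx

theorem IsAdmissibleSeq.ext_of_lt {m : ℕ} (hm : 0 < m) {a b : ℕ → ℕ}
    (ha : IsAdmissibleSeq m a) (hb : IsAdmissibleSeq m b)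
    (h : ∀ x < m, x ∈ Set.range (partialSum a) ↔ x ∈ Set.range (partialSum b)) : a = b := by
  refine partialSum_injective <|
    ((partialSum_strictMono a).range_inj (partialSum_strictMono b)).1 (Set.ext fun x => ?_)
  induction x using Nat.strong_induction_on with
  | _ x ih =>
  rcases lt_or_ge x m with hx | hx
  · exact h x hx
  · obtain ⟨x, rfl⟩ := Nat.exists_eq_add_of_le' hx
    rw [ha.add_mem_range_iff hm, hb.add_mem_range_iff hm, ih x (by omega)]

theorem count_add_count_not (p : ℕ → Prop) [DecidablePred p] (n : ℕ) :
    Nat.count p n + Nat.count (fun k => ¬p k) n = n := by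
  induction n with
  | zero => simp
  | succ n ih => rw [Nat.count_succ, Nat.count_succ]; split_ifs <;> omega

theorem exists_isAdmissibleSeq_range_eq {m : ℕ} {p : ℕ → Prop} (h0 : p 0)
    (hp : ∀ x, p (x + m) ↔ ¬p x) :
    ∃ a, IsAdmissibleSeq m a ∧ ∀ x, x ∈ Set.range (partialSum a) ↔ p x := by
  classical
  have hp₂ (x : ℕ) : p (2 * m + x) ↔ p x := by
    rw [show 2 * m + x = x + m + m by ring, hp, hp, not_not]
  have hm : 0 < m := by
    rcases Nat.eq_zero_or_pos m with rfl | h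
    · have := hp 0
      simp at this
    · exact h
  have hmul (t : ℕ) : p (2 * m * t) := by
    induction t with
    | zero => exact h0
    | succ t ih => rwa [show 2 * m * (t + 1) = 2 * m + 2 * m * t by ring, hp₂]
  have hinf : (Set.ofPred p).Infinite := by
    refine Set.infinite_of_not_bddAbove ?_
    rintro ⟨B, hB⟩
    have h₁ : 2 * m * (B + 1) ≤ B := hB (hmul (B + 1))
    nlinarith
  have hmono := Nat.nth_strictMono hinf
  have hcount : Nat.count p (2 * m) = m := by
    rw [two_mul, Nat.count_add]
    simp only [add_comm m, hp]
    exact count_add_count_not p m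
  have hS (n : ℕ) : partialSum (fun n => Nat.nth p (n + 1) - Nat.nth p n - 1) n =
      Nat.nth p n := by
    induction n with
    | zero => rw [partialSum_zero, Nat.nth_zero_of_zero h0]
    | succ n ih =>
      rw [partialSum_succ, ih]
      have := hmono (Nat.lt_succ_self n)
      simp only [Nat.succ_eq_add_one] at this
      omega
  have hadd (n : ℕ) : Nat.nth p (n + m) = Nat.nth p n + 2 * m := by
    have h₁ : Nat.count p (2 * m + Nat.nth p n) = n + m := by
      rw [Nat.count_add, hcount]
      simp only [hp₂]
      rw [Nat.count_nth_of_infinite hinf, add_comm]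
    rw [← h₁, Nat.nth_count ((hp₂ _).2 (Nat.nth_mem_of_infinite hinf n)), add_comm]
  refine ⟨fun n => Nat.nth p (n + 1) - Nat.nth p n - 1, ⟨fun n => ?_, ?_, fun i j hij => ?_⟩,
    fun x => ?_⟩
  · simp only [show n + m + 1 = n + 1 + m by ring, hadd]
    omega
  · have := hadd 0
    rw [hS]
    rwa [zero_add, Nat.nth_zero_of_zero h0, zero_add] at this
  · rw [hS, hS] at hij
    have := Nat.nth_mem_of_infinite hinf j
    rw [hij, hp] at this
    exact this (Nat.nth_mem_of_infinite hinf i)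
  · rw [show partialSum _ = Nat.nth p from funext hS, Nat.range_nth_of_infinite hinf]
    rfl

theorem card_isAdmissibleSeq {m : ℕ} (hm : 0 < m) :
    Nat.card {a : ℕ → ℕ // IsAdmissibleSeq m a} = 2 ^ (m - 1) := by
  classical
  let F : {a : ℕ → ℕ // IsAdmissibleSeq m a} → (Finset.Ico 1 m).powerset := fun a =>
    ⟨(Finset.Ico 1 m).filter (· ∈ Set.range (partialSum a.1)),
      Finset.mem_powerset.2 (Finset.filter_subset _ _)⟩
  have hF : Function.Bijective F := by
    constructor
    · rintro ⟨a, ha⟩ ⟨b, hb⟩ hab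
      refine Subtype.ext (ha.ext_of_lt hm hb fun x hx => ?_)
      rcases Nat.eq_zero_or_pos x with rfl | hx0
      · exact iff_of_true ⟨0, rfl⟩ ⟨0, rfl⟩
      · have h₁ := Finset.ext_iff.1 (congrArg Subtype.val hab) x
        simpa only [F, Finset.mem_filter, Finset.mem_Ico, hx, Nat.succ_le_of_lt hx0, true_and,
          and_true] using h₁
    · rintro ⟨s, hs⟩
      obtain ⟨a, ha, hap⟩ := exists_isAdmissibleSeq_range_eq (m := m)
        (p := fun x => ((x % m = 0 ∨ x % m ∈ s) ↔ Even (x / m))) (by simp) fun x => by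
          rw [Nat.add_mod_right, Nat.add_div_right _ hm, Nat.even_add_one]
          tauto
      refine ⟨⟨a, ha⟩, Subtype.ext (Finset.ext fun x => ?_)⟩
      simp only [F, Finset.mem_filter, hap]
      constructor
      · rintro ⟨hx, h⟩
        rw [Finset.mem_Ico] at hx
        rw [Nat.mod_eq_of_lt hx.2, Nat.div_eq_of_lt hx.2] at h
        have := h.2 Even.zero
        have : x ≠ 0 := by omega
        tauto
      · intro hx
        have hx' := Finset.mem_powerset.1 hs hx
        refine ⟨hx', ?_⟩
        rw [Finset.mem_Ico] at hx'
        rw [Nat.mod_eq_of_lt hx'.2, Nat.div_eq_of_lt hx'.2]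
        simp [hx]
  rw [Nat.card_eq_of_bijective F hF, Nat.card_eq_fintype_card, Fintype.card_coe,
    Finset.card_powerset, Nat.card_Ico]

theorem isAdmissibleSeq_and_periodic_iff {d e : ℕ} (he : 0 < e) {a : ℕ → ℕ} :
    IsAdmissibleSeq (d * e) a ∧ Function.Periodic a d ↔ Odd e ∧ IsAdmissibleSeq d a := by
  constructor
  · rintro ⟨h, hd⟩
    have hsum : partialSum a d = 2 * d := by
      have h₁ := partialSum_add_mul_period hd 0 e
      rw [zero_add, mul_comm e d, h.sum_eq, partialSum_zero, zero_add] at h₁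
      exact Nat.eq_of_mul_eq_mul_left he (by rw [← h₁]; ring)
    obtain ⟨f, rfl | rfl⟩ := Nat.even_or_odd' e
    · refine absurd ?_ (h.ne_add 0 (0 + f * d))
      rw [partialSum_add_mul_period hd, hsum]
      ring
    · refine ⟨⟨f, rfl⟩, hd, hsum, fun i j hij => h.ne_add i (j + f * d) ?_⟩
      rw [partialSum_add_mul_period hd, hsum, hij]
      ring
  · rintro ⟨⟨f, rfl⟩, h⟩
    refine ⟨⟨?_, ?_, fun i j hij => h.ne_add (i + f * d) j ?_⟩, h.periodic⟩
    · simpa [mul_comm] using h.periodic.nat_mul (2 * f + 1)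
    · have h₁ := partialSum_add_mul_period h.periodic 0 (2 * f + 1)
      rw [zero_add, mul_comm _ d, h.sum_eq, partialSum_zero, zero_add] at h₁
      rw [h₁]
      ring
    · rw [partialSum_add_mul_period h.periodic, h.sum_eq, hij]
      ring

theorem exists_periodic_iff_dvd (a : ℕ → ℕ) : ∃ p, ∀ d, Function.Periodic a d ↔ p ∣ d := by
  let shift : (ℕ → ℕ) → (ℕ → ℕ) := fun a n => a (n + 1)
  have hs (d : ℕ) (a : ℕ → ℕ) : shift^[d] a = fun n => a (n + d) := by
    induction d generalizing a with
    | zero => rfl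
    | succ d ih =>
      rw [Function.iterate_succ_apply, ih]
      rfl
  refine ⟨Function.minimalPeriod shift a, fun d => ?_⟩
  rw [← Function.isPeriodicPt_iff_minimalPeriod_dvd, Function.IsPeriodicPt, Function.IsFixedPt, hs,
    funext_iff]
  rfl

open Classical in
theorem sum_moebius_filter_periodic {N : ℕ} (hN : 0 < N) {a : ℕ → ℕ}
    (ha : Function.Periodic a N) :
    ∑ e ∈ N.divisors with Function.Periodic a (N / e), ArithmeticFunction.moebius e =
      if ∀ d, 1 ≤ d → d ≤ N → Function.Periodic a d → d = N then 1 else 0 := by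
  obtain ⟨p, hp⟩ := exists_periodic_iff_dvd a
  simp only [hp] at ha ⊢
  obtain ⟨q, rfl⟩ := ha
  have hp0 : 0 < p := Nat.pos_of_mul_pos_right hN
  have hq0 : 0 < q := Nat.pos_of_mul_pos_left hN
  have hfilter : (p * q).divisors.filter (fun e => p ∣ p * q / e) = q.divisors := by
    ext e
    simp only [Finset.mem_filter, Nat.mem_divisors]
    constructor
    · rintro ⟨⟨h₁, -⟩, h₂⟩
      obtain ⟨c, hc⟩ := h₂
      refine ⟨⟨c, Nat.eq_of_mul_eq_mul_left hp0 ?_⟩, hq0.ne'⟩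
      rw [← Nat.div_mul_cancel h₁, hc]
      ring
    · rintro ⟨h, -⟩
      refine ⟨⟨h.mul_left p, hN.ne'⟩, ?_⟩
      rw [Nat.mul_div_assoc _ h]
      exact dvd_mul_right _ _
  have hiff : (∀ d, 1 ≤ d → d ≤ p * q → p ∣ d → d = p * q) ↔ q = 1 := by
    constructor
    · intro h
      have := h p hp0 (Nat.le_mul_of_pos_right p hq0) dvd_rfl
      exact (Nat.eq_of_mul_eq_mul_left hp0 (by rw [← this, mul_one])).symm
    · rintro rfl d h₁ h₂ h₃
      rw [mul_one] at h₂ ⊢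
      exact le_antisymm h₂ (Nat.le_of_dvd h₁ h₃)
  rw [hfilter, ← ArithmeticFunction.coe_mul_zeta_apply, ArithmeticFunction.moebius_mul_coe_zeta,
    ArithmeticFunction.one_apply]
  simp only [hiff]

/-- `A_N = ∑_{d ∣ N, d odd} μ(d) · 2^(N/d - 1)`. -/
theorem numAperiodic_eq_moebius_sum (N : ℕ) (hN : 1 ≤ N) :
    (numAperiodic N : ℤ) = ∑ d ∈ N.divisors.filter (fun d => Odd d),
      (ArithmeticFunction.moebius d) * 2 ^ (N / d - 1) := by
  classical
  have hfin : {a : ℕ → ℕ | IsAdmissibleSeq N a}.Finite :=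
    Nat.finite_of_card_ne_zero (α := {a : ℕ → ℕ // IsAdmissibleSeq N a}) (by
      rw [card_isAdmissibleSeq hN]
      positivity)
  have hmem (a : ℕ → ℕ) : a ∈ hfin.toFinset ↔ IsAdmissibleSeq N a := by simp
  have hcard (q : (ℕ → ℕ) → Prop) :
      Nat.card {a : ℕ → ℕ // IsAdmissibleSeq N a ∧ q a} = (hfin.toFinset.filter q).card :=
    Nat.subtype_card _ fun a => by rw [Finset.mem_filter, hmem]
  have hcount : ∀ e ∈ N.divisors,
      ((hfin.toFinset.filter (Function.Periodic · (N / e))).card : ℤ) =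
        if Odd e then 2 ^ (N / e - 1) else 0 := by
    intro e he
    have hdvd := Nat.dvd_of_mem_divisors he
    have he0 := Nat.pos_of_mem_divisors he
    have hiff (a : ℕ → ℕ) := isAdmissibleSeq_and_periodic_iff (d := N / e) he0 (a := a)
    rw [Nat.div_mul_cancel hdvd] at hiff
    rw [← hcard]
    simp only [hiff]
    split_ifs with ho
    · simp only [ho, true_and]
      rw [card_isAdmissibleSeq (Nat.div_pos (Nat.le_of_dvd hN hdvd) he0)]
      norm_cast
    · simp [ho]
  calc (numAperiodic N : ℤ)
      = ∑ a ∈ hfin.toFinset, ∑ e ∈ N.divisors with Function.Periodic a (N / e),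
          ArithmeticFunction.moebius e := by
        rw [numAperiodic_eq_card hN, hcard, Finset.card_filter, Nat.cast_sum]
        refine Finset.sum_congr rfl fun a ha => ?_
        rw [sum_moebius_filter_periodic hN ((hmem a).1 ha).periodic]
        split_ifs <;> rfl
    _ = ∑ e ∈ N.divisors, ArithmeticFunction.moebius e *
          ((hfin.toFinset.filter (Function.Periodic · (N / e))).card : ℤ) := by
        simp only [Finset.sum_filter]
        rw [Finset.sum_comm]
        refine Finset.sum_congr rfl fun e _ => ?_
        rw [← Finset.sum_filter, Finset.sum_const, nsmul_eq_mul, mul_comm]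
    _ = _ := by
        rw [Finset.sum_filter]
        refine Finset.sum_congr rfl fun e he => ?_
        rw [hcount e he, mul_ite, mul_zero]
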